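/- arXiv:2605.02876 — 2 statements merged into one kernel-verified Lean document; each statement's English description precedes it below -/
import Mathlib

section
/- Let ψ ∈ ℂ⁸ be a unit vector and ρ = ψψ† the corresponding pure three-qubit state, and let n1, n2 ∈ ℝ³ be unit vectors. If |I(n1,n2;ρ)| = 2, then there exist signs ε₁, ε₂, ε₃, ε₄ ∈ {−1, +1} with O_i·ψ = ε_i·ψ for i = 1,2,3,4 and ε₁·ε₂·ε₃ = −ε₄. -/
open Matrix Kronecker
open scoped ComplexOrder

noncomputable section

/-- Pauli matrices. -/
def σx : Matrix (Fin 2) (Fin 2) ℂ := !![0, 1; 1, 0]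
def σy : Matrix (Fin 2) (Fin 2) ℂ := !![0, -Complex.I; Complex.I, 0]
def σz : Matrix (Fin 2) (Fin 2) ℂ := !![1, 0; 0, -1]

/-- Spin observable along direction `n`. -/
def spin (n : Fin 3 → ℝ) : Matrix (Fin 2) (Fin 2) ℂ :=
  (n 0 : ℂ) • σx + (n 1 : ℂ) • σy + (n 2 : ℂ) • σz

/-- Index type for three qubits: `ℂ² ⊗ ℂ² ⊗ ℂ² ≅ ℂ⁸`. -/
abbrev Q3 := (Fin 2 × Fin 2) × Fin 2

/-- `n` is a unit vector in `ℝ³`. -/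
def IsUnitVec (n : Fin 3 → ℝ) : Prop := n 0 ^ 2 + n 1 ^ 2 + n 2 ^ 2 = 1

/-- Euclidean dot product on `ℝ³`. -/
def dot3 (a b : Fin 3 → ℝ) : ℝ := a 0 * b 0 + a 1 * b 1 + a 2 * b 2

def O1 (n1 n2 : Fin 3 → ℝ) : Matrix Q3 Q3 ℂ := spin n1 ⊗ₖ spin n2 ⊗ₖ spin n2
def O2 (n1 n2 : Fin 3 → ℝ) : Matrix Q3 Q3 ℂ := spin n2 ⊗ₖ spin n1 ⊗ₖ spin n2
def O3 (n1 n2 : Fin 3 → ℝ) : Matrix Q3 Q3 ℂ := spin n2 ⊗ₖ spin n2 ⊗ₖ spin n1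
def O4 (n1 n2 : Fin 3 → ℝ) : Matrix Q3 Q3 ℂ := spin n1 ⊗ₖ spin n1 ⊗ₖ spin n1

/-- The functional `I(n1,n2;ρ) = e₄ − e₁e₂e₃` with `eᵢ = Re Tr(Oᵢ ρ)`. -/
def Ifun (n1 n2 : Fin 3 → ℝ) (ρ : Matrix Q3 Q3 ℂ) : ℝ :=
  ((O4 n1 n2 * ρ).trace).re -
    ((O1 n1 n2 * ρ).trace).re * ((O2 n1 n2 * ρ).trace).re * ((O3 n1 n2 * ρ).trace).re

/-- Computational basis state `|ijk⟩` of three qubits. -/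
def ket (i j k : Fin 2) : Q3 → ℂ := fun p => if p = ((i, j), k) then 1 else 0

/-- Expectation value `Re ⟨ψ, M ψ⟩` of an observable `M` in a pure state `ψ`. -/
def eexp (M : Matrix Q3 Q3 ℂ) (ψ : Q3 → ℂ) : ℝ := (star ψ ⬝ᵥ M.mulVec ψ).re

/-- The functional `I` evaluated on a pure state `ρ = ψψ†`. -/
def Ipure (n1 n2 : Fin 3 → ℝ) (ψ : Q3 → ℂ) : ℝ :=
  eexp (O4 n1 n2) ψ - eexp (O1 n1 n2) ψ * eexp (O2 n1 n2) ψ * eexp (O3 n1 n2) ψ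

theorem spin_isHermitian (n : Fin 3 → ℝ) : (spin n).IsHermitian := by
  ext i j
  fin_cases i <;> fin_cases j <;> simp [spin, σx, σy, σz]

theorem spin_mul_self {n : Fin 3 → ℝ} (h : IsUnitVec n) : spin n * spin n = 1 := by
  have hc : (n 0 : ℂ) ^ 2 + (n 1 : ℂ) ^ 2 + (n 2 : ℂ) ^ 2 = 1 := by
    exact_mod_cast h
  ext i j
  fin_cases i <;> fin_cases j <;>
    simp [spin, σx, σy, σz, Matrix.mul_apply, Fin.sum_univ_two] <;>
    first
    | ring1
    | linear_combination hc - (n 1 : ℂ) ^ 2 * Complex.I_sq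

theorem kronecker_spin_isHermitian (a b c : Fin 3 → ℝ) :
    (spin a ⊗ₖ spin b ⊗ₖ spin c).IsHermitian := by
  simp only [Matrix.IsHermitian, conjTranspose_kronecker, (spin_isHermitian _).eq]

theorem kronecker_spin_mul_self {a b c : Fin 3 → ℝ}
    (ha : IsUnitVec a) (hb : IsUnitVec b) (hc : IsUnitVec c) :
    (spin a ⊗ₖ spin b ⊗ₖ spin c) * (spin a ⊗ₖ spin b ⊗ₖ spin c) = 1 := by
  simp only [← mul_kronecker_mul, spin_mul_self ha, spin_mul_self hb, spin_mul_self hc,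
    one_kronecker_one]

theorem re_star_dotProduct_residual {M : Matrix Q3 Q3 ℂ} {ψ : Q3 → ℂ}
    (hψ : star ψ ⬝ᵥ ψ = 1) (hM : M.IsHermitian) (hMM : M * M = 1) :
    (star (M.mulVec ψ - (eexp M ψ : ℂ) • ψ) ⬝ᵥ
      (M.mulVec ψ - (eexp M ψ : ℂ) • ψ)).re = 1 - eexp M ψ ^ 2 := by
  have hadj (v : Q3 → ℂ) : star (M.mulVec ψ) ⬝ᵥ v = star ψ ⬝ᵥ M.mulVec v := by
    rw [star_mulVec, hM.eq, ← dotProduct_mulVec]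
  simp only [star_sub, star_smul, sub_dotProduct, dotProduct_sub, smul_dotProduct,
    dotProduct_smul, hadj, mulVec_mulVec, hMM, one_mulVec, hψ]
  simp only [smul_eq_mul, Complex.sub_re, Complex.one_re, mul_one, Complex.star_def,
    Complex.conj_ofReal, Complex.re_ofReal_mul, Complex.ofReal_re]
  simp only [eexp]
  ring

theorem eexp_sq_le_one {M : Matrix Q3 Q3 ℂ} {ψ : Q3 → ℂ}
    (hψ : star ψ ⬝ᵥ ψ = 1) (hM : M.IsHermitian) (hMM : M * M = 1) :
    eexp M ψ ^ 2 ≤ 1 := by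
  have h := (Complex.le_def.1
    (dotProduct_star_self_nonneg (M.mulVec ψ - (eexp M ψ : ℂ) • ψ))).1
  rw [Complex.zero_re, re_star_dotProduct_residual hψ hM hMM] at h
  linarith

theorem mulVec_eq_eexp_smul {M : Matrix Q3 Q3 ℂ} {ψ : Q3 → ℂ}
    (hψ : star ψ ⬝ᵥ ψ = 1) (hM : M.IsHermitian) (hMM : M * M = 1)
    (he : eexp M ψ ^ 2 = 1) : M.mulVec ψ = (eexp M ψ : ℂ) • ψ := by
  have h := re_star_dotProduct_residual hψ hM hMM
  rw [he, sub_self] at h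
  have him := (Complex.le_def.1
    (dotProduct_star_self_nonneg (M.mulVec ψ - (eexp M ψ : ℂ) • ψ))).2
  rw [← sub_eq_zero, ← dotProduct_star_self_eq_zero]
  exact Complex.ext h him.symm

theorem sq_eq_one_of_abs_sub_mul_eq_two {a b c d : ℝ} (ha : a ^ 2 ≤ 1) (hb : b ^ 2 ≤ 1)
    (hc : c ^ 2 ≤ 1) (hd : d ^ 2 ≤ 1) (h : |d - a * b * c| = 2) :
    a ^ 2 = 1 ∧ b ^ 2 = 1 ∧ c ^ 2 = 1 ∧ d ^ 2 = 1 ∧ a * b * c = -d := by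
  have hab : a ^ 2 * b ^ 2 ≤ 1 := mul_le_one₀ ha (sq_nonneg b) hb
  have habc : a ^ 2 * b ^ 2 * c ^ 2 ≤ 1 := mul_le_one₀ hab (sq_nonneg c) hc
  have hsq : (d - a * b * c) ^ 2 = 4 := by rw [← sq_abs, h]; norm_num
  have hneg : a * b * c = -d := by
    have : (d + a * b * c) ^ 2 = 0 := by
      apply le_antisymm _ (sq_nonneg _)
      nlinarith
    linarith [pow_eq_zero_iff (two_ne_zero) |>.1 this]
  have hd1 : d ^ 2 = 1 := by rw [hneg] at hsq; linarith
  have hprod : a ^ 2 * b ^ 2 * c ^ 2 = 1 := by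
    rw [← mul_pow, ← mul_pow, hneg, neg_sq, hd1]
  refine ⟨?_, ?_, ?_, hd1, hneg⟩ <;>
    nlinarith [sq_nonneg a, sq_nonneg b, sq_nonneg c, mul_nonneg (sq_nonneg a) (sq_nonneg b),
      mul_nonneg (sq_nonneg a) (sq_nonneg c), mul_nonneg (sq_nonneg b) (sq_nonneg c),
      mul_le_one₀ hb (sq_nonneg c) hc, mul_le_one₀ ha (sq_nonneg c) hc]

theorem saturation_forces_common_eigenstate (ψ : Q3 → ℂ)
    (hψ : star ψ ⬝ᵥ ψ = 1)
    (n1 n2 : Fin 3 → ℝ) (h1 : IsUnitVec n1) (h2 : IsUnitVec n2)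
    (hsat : |Ipure n1 n2 ψ| = 2) :
    ∃ ε1 ε2 ε3 ε4 : ℝ,
      (ε1 = 1 ∨ ε1 = -1) ∧ (ε2 = 1 ∨ ε2 = -1) ∧ (ε3 = 1 ∨ ε3 = -1) ∧ (ε4 = 1 ∨ ε4 = -1) ∧
      (O1 n1 n2).mulVec ψ = (ε1 : ℂ) • ψ ∧
      (O2 n1 n2).mulVec ψ = (ε2 : ℂ) • ψ ∧
      (O3 n1 n2).mulVec ψ = (ε3 : ℂ) • ψ ∧
      (O4 n1 n2).mulVec ψ = (ε4 : ℂ) • ψ ∧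
      ε1 * ε2 * ε3 = -ε4 := by
  have hH1 : (O1 n1 n2).IsHermitian := kronecker_spin_isHermitian n1 n2 n2
  have hH2 : (O2 n1 n2).IsHermitian := kronecker_spin_isHermitian n2 n1 n2
  have hH3 : (O3 n1 n2).IsHermitian := kronecker_spin_isHermitian n2 n2 n1
  have hH4 : (O4 n1 n2).IsHermitian := kronecker_spin_isHermitian n1 n1 n1
  have hS1 : O1 n1 n2 * O1 n1 n2 = 1 := kronecker_spin_mul_self h1 h2 h2
  have hS2 : O2 n1 n2 * O2 n1 n2 = 1 := kronecker_spin_mul_self h2 h1 h2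
  have hS3 : O3 n1 n2 * O3 n1 n2 = 1 := kronecker_spin_mul_self h2 h2 h1
  have hS4 : O4 n1 n2 * O4 n1 n2 = 1 := kronecker_spin_mul_self h1 h1 h1
  obtain ⟨e1, e2, e3, e4, hprod⟩ := sq_eq_one_of_abs_sub_mul_eq_two
    (eexp_sq_le_one hψ hH1 hS1) (eexp_sq_le_one hψ hH2 hS2)
    (eexp_sq_le_one hψ hH3 hS3) (eexp_sq_le_one hψ hH4 hS4) hsat
  exact ⟨_, _, _, _, sq_eq_one_iff.1 e1, sq_eq_one_iff.1 e2,
    sq_eq_one_iff.1 e3, sq_eq_one_iff.1 e4,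
    mulVec_eq_eexp_smul hψ hH1 hS1 e1, mulVec_eq_eexp_smul hψ hH2 hS2 e2,
    mulVec_eq_eexp_smul hψ hH3 hS3 e3, mulVec_eq_eexp_smul hψ hH4 hS4 e4, hprod⟩
end
end

section
/- For every i, j, k ∈ {0,1} and every sign s ∈ {−1,+1}, the GHZ-basis state ψ = (|ijk⟩ + s·|ī j̄ k̄⟩)/√2 (where ī = 1−i, etc.) is a common eigenvector of the four operators O1 = σx⊗σy⊗σy, O2 = σy⊗σx⊗σy, O3 = σy⊗σy⊗σx, O4 = σx⊗σx⊗σx with eigenvalues ε₁, ε₂, ε₃, ε₄ ∈ {−1,+1} satisfying ε₁·ε₂·ε₃·ε₄ = −1, and consequently |I(x̂,ŷ;ψψ†)| = 2. -/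
open Matrix Kronecker
open scoped ComplexOrder

noncomputable section

/-- The sign `(-1) ^ i` of a bit. -/
def bitSign (i : Fin 2) : ℝ := if i = 0 then 1 else -1

lemma bitSign_eq_or (i : Fin 2) : bitSign i = 1 ∨ bitSign i = -1 := by
  unfold bitSign; split_ifs <;> simp

lemma bitSign_flip (i : Fin 2) : bitSign (1 - i) = -bitSign i := by
  fin_cases i <;> simp [bitSign]

lemma σx_apply (a i : Fin 2) : σx a i = if a = 1 - i then 1 else 0 := by
  fin_cases a <;> fin_cases i <;> simp [σx]

lemma σy_apply (a i : Fin 2) :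
    σy a i = if a = 1 - i then Complex.I * bitSign i else 0 := by
  fin_cases a <;> fin_cases i <;> simp [σy, bitSign]

lemma kronecker_mulVec_ket_apply (A B C : Matrix (Fin 2) (Fin 2) ℂ) (i j k : Fin 2) (p : Q3) :
    (A ⊗ₖ B ⊗ₖ C).mulVec (ket i j k) p = A p.1.1 i * B p.1.2 j * C p.2 k := by
  simp [mulVec, dotProduct, ket]

/-- A tensor product of operators flipping the bits `i`, `j`, `k` up to scalars flips the
corresponding basis state up to the product of the scalars. -/
lemma kronecker_mulVec_ket {A B C : Matrix (Fin 2) (Fin 2) ℂ} {i j k : Fin 2} {α β γ : ℂ}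
    (hA : ∀ a, A a i = if a = 1 - i then α else 0)
    (hB : ∀ a, B a j = if a = 1 - j then β else 0)
    (hC : ∀ a, C a k = if a = 1 - k then γ else 0) :
    (A ⊗ₖ B ⊗ₖ C).mulVec (ket i j k) = (α * β * γ) • ket (1 - i) (1 - j) (1 - k) := by
  ext ⟨⟨a, b⟩, c⟩
  rw [kronecker_mulVec_ket_apply, hA, hB, hC]
  by_cases ha : a = 1 - i <;> by_cases hb : b = 1 - j <;> by_cases hc : c = 1 - k <;>
    simp [ket, ha, hb, hc]

lemma mulVec_swap_eigenvector {M : Matrix Q3 Q3 ℂ} {u v : Q3 → ℂ} {c s : ℂ} (r : ℂ)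
    (hu : M.mulVec u = c • v) (hv : M.mulVec v = c • u) (hs : s * s = 1) :
    M.mulVec (r • (u + s • v)) = (c * s) • (r • (u + s • v)) := by
  rw [mulVec_smul, mulVec_add, mulVec_smul, hu, hv]
  ext p
  simp only [Pi.smul_apply, Pi.add_apply, smul_eq_mul]
  linear_combination (-(r * c * v p)) * hs

lemma eexp_of_eigenvector {M : Matrix Q3 Q3 ℂ} {ψ : Q3 → ℂ} {ε : ℝ}
    (hψ : star ψ ⬝ᵥ ψ = 1) (h : M.mulVec ψ = (ε : ℂ) • ψ) : eexp M ψ = ε := by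
  simp [eexp, h, dotProduct_smul, hψ]

lemma spin_x : spin ![1, 0, 0] = σx := by simp [spin]

lemma spin_y : spin ![0, 1, 0] = σy := by simp [spin]

lemma star_ket (i j k : Fin 2) : star (ket i j k) = ket i j k := by
  ext p; simp [ket, apply_ite]

lemma ket_dotProduct (i j k : Fin 2) (v : Q3 → ℂ) : ket i j k ⬝ᵥ v = v ((i, j), k) := by
  simp [dotProduct, ket]

lemma star_dotProduct_GHZ (i j k : Fin 2) {s : ℝ} (hs : s * s = 1) :
    star (((Real.sqrt 2 : ℂ))⁻¹ • (ket i j k + (s : ℂ) • ket (1 - i) (1 - j) (1 - k))) ⬝ᵥ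
      (((Real.sqrt 2 : ℂ))⁻¹ • (ket i j k + (s : ℂ) • ket (1 - i) (1 - j) (1 - k))) = 1 := by
  have hs' : (s : ℂ) * s = 1 := by exact_mod_cast hs
  have h2 : ((Real.sqrt 2 : ℂ))⁻¹ * ((Real.sqrt 2 : ℂ))⁻¹ = 1 / 2 := by
    rw [← mul_inv, ← Complex.ofReal_mul, Real.mul_self_sqrt (by norm_num)]
    norm_num
  have hne : i ≠ 1 - i := by fin_cases i <;> decide
  simp only [star_smul, star_add, star_ket, smul_dotProduct, add_dotProduct, dotProduct_smul,
    dotProduct_add, ket_dotProduct]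
  simp [ket, hne, hne.symm]
  linear_combination (1 + (s : ℂ) * s) * h2 + (1 / 2) * hs'

theorem GHZ_basis_common_eigenstates (i j k : Fin 2) (s : ℝ) (hs : s = 1 ∨ s = -1) :
    ∀ ψ : Q3 → ℂ, ψ = ((Real.sqrt 2 : ℂ))⁻¹ • (ket i j k + (s : ℂ) • ket (1 - i) (1 - j) (1 - k)) →
    ∃ ε1 ε2 ε3 ε4 : ℝ,
      (ε1 = 1 ∨ ε1 = -1) ∧ (ε2 = 1 ∨ ε2 = -1) ∧ (ε3 = 1 ∨ ε3 = -1) ∧ (ε4 = 1 ∨ ε4 = -1) ∧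
      (σx ⊗ₖ σy ⊗ₖ σy).mulVec ψ = (ε1 : ℂ) • ψ ∧
      (σy ⊗ₖ σx ⊗ₖ σy).mulVec ψ = (ε2 : ℂ) • ψ ∧
      (σy ⊗ₖ σy ⊗ₖ σx).mulVec ψ = (ε3 : ℂ) • ψ ∧
      (σx ⊗ₖ σx ⊗ₖ σx).mulVec ψ = (ε4 : ℂ) • ψ ∧
      ε1 * ε2 * ε3 * ε4 = -1 ∧
      |Ipure ![1, 0, 0] ![0, 1, 0] ψ| = 2 := by
  rintro ψ rfl
  have hss : s * s = 1 := by rcases hs with rfl | rfl <;> norm_num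
  have hss' : (s : ℂ) * s = 1 := by exact_mod_cast hss
  have flip (a : Fin 2) : 1 - (1 - a) = a := sub_sub_cancel 1 a
  have hsign (a b : Fin 2) :
      -(bitSign a * bitSign b) * s = 1 ∨ -(bitSign a * bitSign b) * s = -1 := by
    rcases bitSign_eq_or a with ha | ha <;> rcases bitSign_eq_or b with hb | hb <;>
      rcases hs with rfl | rfl <;> simp [ha, hb]
  have hsq (a : Fin 2) : bitSign a * bitSign a = 1 := by
    rcases bitSign_eq_or a with ha | ha <;> simp [ha]
  set r : ℂ := ((Real.sqrt 2 : ℂ))⁻¹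
  set ψ : Q3 → ℂ := r • (ket i j k + (s : ℂ) • ket (1 - i) (1 - j) (1 - k))
  have eigen {A B C : Matrix (Fin 2) (Fin 2) ℂ} {f g h : Fin 2 → ℂ} (c : ℝ)
      (hA : ∀ a i, A a i = if a = 1 - i then f i else 0)
      (hB : ∀ a i, B a i = if a = 1 - i then g i else 0)
      (hC : ∀ a i, C a i = if a = 1 - i then h i else 0)
      (hc : f i * g j * h k = c) (hc' : f (1 - i) * g (1 - j) * h (1 - k) = c) :
      (A ⊗ₖ B ⊗ₖ C).mulVec ψ = ((c * s : ℝ) : ℂ) • ψ := by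
    rw [Complex.ofReal_mul]
    refine mulVec_swap_eigenvector r ?_ ?_ hss'
    · rw [kronecker_mulVec_ket (hA · i) (hB · j) (hC · k), hc]
    · rw [kronecker_mulVec_ket (hA · _) (hB · _) (hC · _), hc', flip, flip, flip]
  have e1 := eigen (-(bitSign j * bitSign k)) σx_apply σy_apply σy_apply
    (by push_cast; linear_combination (bitSign j * bitSign k : ℂ) * Complex.I_mul_I)
    (by simp only [bitSign_flip]; push_cast
        linear_combination (bitSign j * bitSign k : ℂ) * Complex.I_mul_I)
  have e2 := eigen (-(bitSign i * bitSign k)) σy_apply σx_apply σy_apply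
    (by push_cast; linear_combination (bitSign i * bitSign k : ℂ) * Complex.I_mul_I)
    (by simp only [bitSign_flip]; push_cast
        linear_combination (bitSign i * bitSign k : ℂ) * Complex.I_mul_I)
  have e3 := eigen (-(bitSign i * bitSign j)) σy_apply σy_apply σx_apply
    (by push_cast; linear_combination (bitSign i * bitSign j : ℂ) * Complex.I_mul_I)
    (by simp only [bitSign_flip]; push_cast
        linear_combination (bitSign i * bitSign j : ℂ) * Complex.I_mul_I)
  have e4 := eigen 1 σx_apply σx_apply σx_apply (by simp) (by simp)
  rw [one_mul] at e4
  have hnorm : star ψ ⬝ᵥ ψ = 1 := star_dotProduct_GHZ i j k hss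
  have hprod : (-(bitSign j * bitSign k) * s) * (-(bitSign i * bitSign k) * s) *
      (-(bitSign i * bitSign j) * s) = -s := by
    calc _ = -((bitSign i * bitSign i) * (bitSign j * bitSign j) * (bitSign k * bitSign k) *
          (s * s) * s) := by ring
      _ = -s := by rw [hsq, hsq, hsq, hss]; ring
  refine ⟨_, _, _, s, hsign j k, hsign i k, hsign i j, hs, e1, e2, e3, e4, ?_, ?_⟩
  · rw [hprod, neg_mul, hss]
  · rw [Ipure, O1, O2, O3, O4, spin_x, spin_y, eexp_of_eigenvector hnorm e1,
      eexp_of_eigenvector hnorm e2, eexp_of_eigenvector hnorm e3, eexp_of_eigenvector hnorm e4,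
      hprod]
    rcases hs with rfl | rfl <;> norm_num
end
end
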